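/- Let p be a factorized transition density, let E ⊆ X be measurable with μ(E) > 0, assume E-faithfulness, and let G be a bipartite graph from I to J such that some edge (i,j) of the local causal graph G_E is not an edge of G. Then there is no f ∈ F_E(G) with f(x,·) = p(x,·) ν-a.e. for μ-a.e. x ∈ E, and consequently inf_{f ∈ F_E(G)} KL_E(p, f) > 0. -/

import Mathlib

open MeasureTheory
open scoped ENNReal

namespace FCDL

variable {N M : ℕ}
variable {X : Fin (N + M) → Type*} {Y : Fin N → Type*}
variable [∀ i, MeasurableSpace (X i)] [∀ j, MeasurableSpace (Y j)]

/-- Restriction of `x : ∀ i, X i` to the coordinates in the finite index set `T`. -/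
def restr (T : Finset (Fin (N + M))) (x : ∀ i, X i) :
    (i : {i // i ∈ T}) → X i.val :=
  fun i => x i.val

/-- `pj` is the family of conditional factors of a factorized transition density:
each `pj j` is jointly measurable, strictly positive, and `pj j x ·` is a probability
density with respect to `ν j` for every `x`. -/
structure IsFTD (ν : ∀ j, Measure (Y j)) (pj : ∀ j, (∀ i, X i) → Y j → ℝ) : Prop where
  measurable : ∀ j, Measurable (Function.uncurry (pj j))
  pos : ∀ j x y, 0 < pj j x y
  density : ∀ j x, ∫ y, pj j x y ∂(ν j) = 1

/-- The full factorized transition density `p(x,y) = ∏ j, p_j(x, y_j)`. -/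
def Pfull (pj : ∀ j, (∀ i, X i) → Y j → ℝ) (x : ∀ i, X i) (y : ∀ j, Y j) : ℝ :=
  ∏ j, pj j x (y j)

/-- `T` is a local parent set for output `j` on the context `E`: on `E`, the conditional
density of `Y j` depends on `x` only through the coordinates `x_T`. -/
def IsLPS (μ : Measure (∀ i, X i)) (ν : ∀ j, Measure (Y j))
    (pj : ∀ j, (∀ i, X i) → Y j → ℝ) (E : Set (∀ i, X i)) (j : Fin N)
    (T : Finset (Fin (N + M))) : Prop :=
  ∃ g : ((i : {i // i ∈ T}) → X i.val) → Y j → ℝ,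
    Measurable (Function.uncurry g) ∧
    ∀ᵐ x ∂μ, x ∈ E → (∀ᵐ y ∂(ν j), pj j x y = g (restr T x) y)

/-- `T` is an inclusion-minimal local parent set for `j` on `E`. -/
def IsMinLPS (μ : Measure (∀ i, X i)) (ν : ∀ j, Measure (Y j))
    (pj : ∀ j, (∀ i, X i) → Y j → ℝ) (E : Set (∀ i, X i)) (j : Fin N)
    (T : Finset (Fin (N + M))) : Prop :=
  IsLPS μ ν pj E j T ∧ ∀ T' : Finset (Fin (N + M)), T' ⊂ T → ¬ IsLPS μ ν pj E j T'

/-- `E`-faithfulness: every local parent set for `j` on `E` contains the minimal local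
parent set `Pa(j;E)` (so the minimal local parent set is unique). -/
def Faithful (μ : Measure (∀ i, X i)) (ν : ∀ j, Measure (Y j))
    (pj : ∀ j, (∀ i, X i) → Y j → ℝ) (E : Set (∀ i, X i)) : Prop :=
  ∀ (j : Fin N) (P T : Finset (Fin (N + M))),
    IsMinLPS μ ν pj E j P → IsLPS μ ν pj E j T → P ⊆ T

/-- A bipartite graph from `I` to `J` is encoded by its parent map `j ↦ Pa^G(j)`;
`edgeCount G` is its number of edges `|G|`. -/
def edgeCount (G : Fin N → Finset (Fin (N + M))) : ℕ := ∑ j, (G j).card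

/-- Membership in the class `F_E(G)` of strictly positive transition densities which,
on `E`, factorize through the parents prescribed by the graph `G`. -/
def MemF (ν : ∀ j, Measure (Y j)) (E : Set (∀ i, X i))
    (G : Fin N → Finset (Fin (N + M)))
    (f : (∀ i, X i) → (∀ j, Y j) → ℝ) : Prop :=
  Measurable (Function.uncurry f) ∧
  (∀ x y, 0 < f x y) ∧
  (∀ x, ∫ y, f x y ∂(Measure.pi ν) = 1) ∧
  ∃ fj : ∀ j : Fin N, ((i : {i // i ∈ G j}) → X i.val) → Y j → ℝ,
    (∀ j, Measurable (Function.uncurry (fj j))) ∧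
    (∀ j, ∀ x ∈ E, ∫ y, fj j (restr (G j) x) y ∂(ν j) = 1) ∧
    (∀ x ∈ E, ∀ y : ∀ j, Y j, f x y = ∏ j, fj j (restr (G j) x) (y j))

/-- The conditional probability measure `μ_E = μ(· ∩ E)/μ(E)`. -/
noncomputable def condMeasure (μ : Measure (∀ i, X i)) (E : Set (∀ i, X i)) :
    Measure (∀ i, X i) := (μ E)⁻¹ • μ.restrict E

open Classical in
/-- `KL_E(p, f) = ∫ μ_E(dx) ∫ p(x,y) log (p(x,y)/f(x,y)) ν(dy) ∈ [0,∞]`, with the usual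
convention that a non-integrable inner relative entropy is `∞`. -/
noncomputable def klE (μ : Measure (∀ i, X i)) (ν : ∀ j, Measure (Y j))
    (p f : (∀ i, X i) → (∀ j, Y j) → ℝ) (E : Set (∀ i, X i)) : ℝ≥0∞ :=
  ∫⁻ x, (if Integrable (fun y => p x y * Real.log (p x y / f x y)) (Measure.pi ν)
      then ENNReal.ofReal (∫ y, p x y * Real.log (p x y / f x y) ∂(Measure.pi ν))
      else ⊤) ∂(condMeasure μ E)

/-- A `K`-decomposition: a measurable partition of the state-action space into `K`
cells of positive measure. -/
structure IsDecomp (μ : Measure (∀ i, X i)) {K : ℕ} (E : Fin K → Set (∀ i, X i)) : Prop where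
  measurableSet : ∀ z, MeasurableSet (E z)
  pos : ∀ z, 0 < μ (E z)
  disjoint : Pairwise (Function.onFun Disjoint E)
  cover : (⋃ z, E z) = Set.univ

/-- The regularized maximum-likelihood score `S({G_z, E_z})`, valued in the extended reals. -/
noncomputable def score (μ : Measure (∀ i, X i)) (ν : ∀ j, Measure (Y j))
    (pj : ∀ j, (∀ i, X i) → Y j → ℝ) (lam : ℝ) {K : ℕ}
    (E : Fin K → Set (∀ i, X i)) (G : Fin K → (Fin N → Finset (Fin (N + M)))) : EReal :=
  sSup { r : EReal | ∃ f : Fin K → ((∀ i, X i) → (∀ j, Y j) → ℝ),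
      (∀ z, MemF ν (E z) (G z) (f z)) ∧
      r = ((∑ z, ∫ x in E z, ∫ y, Pfull pj x y * Real.log (f z x y)
              ∂(Measure.pi ν) ∂μ : ℝ) : EReal) }
    - ((lam * ∑ z, (μ (E z)).toReal * (edgeCount (G z) : ℝ) : ℝ) : EReal)

/-- The entropy condition: `p log p` is integrable with respect to `μ ⊗ ν`. -/
def EntropyCond (μ : Measure (∀ i, X i)) (ν : ∀ j, Measure (Y j))
    (pj : ∀ j, (∀ i, X i) → Y j → ℝ) : Prop :=
  Integrable (fun q : (∀ i, X i) × (∀ j, Y j) =>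
    Pfull pj q.1 q.2 * Real.log (Pfull pj q.1 q.2)) (μ.prod (Measure.pi ν))

open Classical in
/-- The local causal graph `G_E` (the family of minimal local parent sets), chosen via
choice; under faithfulness it is the unique minimal local parent set family. -/
noncomputable def theLCG (μ : Measure (∀ i, X i)) (ν : ∀ j, Measure (Y j))
    (pj : ∀ j, (∀ i, X i) → Y j → ℝ) (E : Set (∀ i, X i)) :
    Fin N → Finset (Fin (N + M)) :=
  fun j => if h : ∃ T, IsMinLPS μ ν pj E j T then h.choose else ∅

/-- `η({E_z})`: the minimum over cells `z` of the (normalized) smallest KL gap over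
graphs `G'` that miss an edge of `G_{E_z}` and have fewer edges. -/
noncomputable def etaDecomp (μ : Measure (∀ i, X i)) (ν : ∀ j, Measure (Y j))
    (pj : ∀ j, (∀ i, X i) → Y j → ℝ) {K : ℕ} (E : Fin K → Set (∀ i, X i)) : ℝ≥0∞ :=
  ⨅ z : Fin K, ⨅ G' ∈ {G' : Fin N → Finset (Fin (N + M)) |
      (¬ ∀ j, theLCG μ ν pj (E z) j ⊆ G' j) ∧
        edgeCount G' < edgeCount (theLCG μ ν pj (E z))},
    ENNReal.ofReal (1 / ((N : ℝ) * (N + M) + 1)) *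
      ⨅ f ∈ {f | MemF ν (E z) G' f}, klE μ ν (Pfull pj) f (E z)

/-- `η* = inf` of `η({E_z})` over all `K`-decompositions. -/
noncomputable def etaStar (μ : Measure (∀ i, X i)) (ν : ∀ j, Measure (Y j))
    (pj : ∀ j, (∀ i, X i) → Y j → ℝ) (K : ℕ) : ℝ≥0∞ :=
  ⨅ E ∈ {E : Fin K → Set (∀ i, X i) | IsDecomp μ E}, etaDecomp μ ν pj E

/-- `D` is canonical: every positive-measure measurable subset of `D` has the same
local causal graph as `D`. -/
def Canonical (μ : Measure (∀ i, X i)) (ν : ∀ j, Measure (Y j))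
    (pj : ∀ j, (∀ i, X i) → Y j → ℝ) (D : Set (∀ i, X i)) : Prop :=
  ∀ C : Set (∀ i, X i), MeasurableSet C → C ⊆ D → 0 < μ C →
    ∀ (j : Fin N) (T : Finset (Fin (N + M))),
      IsMinLPS μ ν pj C j T ↔ IsMinLPS μ ν pj D j T


/-- Hellinger-type lower bound on the relative entropy of product densities. -/
lemma hellinger_le {ι : Type*} [Fintype ι] {Z : ι → Type*} [∀ k, MeasurableSpace (Z k)]
    (ν : ∀ k, Measure (Z k)) [∀ k, SigmaFinite (ν k)]
    (p q : ∀ k, Z k → ℝ) (hpm : ∀ k, Measurable (p k)) (hqm : ∀ k, Measurable (q k))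
    (hp : ∀ k y, 0 < p k y) (hq : ∀ k y, 0 < q k y)
    (hp1 : ∀ k, ∫ y, p k y ∂(ν k) = 1) (hq1 : ∀ k, ∫ y, q k y ∂(ν k) = 1)
    (hint : Integrable (fun y : ∀ k, Z k => (∏ k, p k (y k)) *
      Real.log ((∏ k, p k (y k)) / ∏ k, q k (y k))) (Measure.pi ν)) (j : ι) :
    ∫⁻ y, ENNReal.ofReal ((√(p j y) - √(q j y)) ^ 2) ∂(ν j) ≤
      ENNReal.ofReal (∫ y : ∀ k, Z k, (∏ k, p k (y k)) *
      Real.log ((∏ k, p k (y k)) / ∏ k, q k (y k)) ∂(Measure.pi ν)) := by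
  classical
  have hpi : ∀ k, Integrable (p k) (ν k) := fun k => by
    by_contra h; simpa [integral_undef h] using hp1 k
  have hqi : ∀ k, Integrable (q k) (ν k) := fun k => by
    by_contra h; simpa [integral_undef h] using hq1 k
  have hai : ∀ k, Integrable (fun y => √(p k y) * √(q k y)) (ν k) := fun k => by
    refine Integrable.mono' (((hpi k).add (hqi k)).div_const 2)
      ((hpm k).sqrt.mul (hqm k).sqrt).aestronglyMeasurable (ae_of_all _ fun y => ?_)
    rw [Real.norm_of_nonneg (by positivity)]
    have h1 := Real.sq_sqrt (hp k y).le
    have h2 := Real.sq_sqrt (hq k y).le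
    simp only [Pi.add_apply]
    nlinarith [sq_nonneg (√(p k y) - √(q k y))]
  have hsq : ∀ k y, (√(p k y) - √(q k y)) ^ 2 = p k y + q k y - 2 * (√(p k y) * √(q k y)) := by
    intro k y
    have h1 := Real.sq_sqrt (hp k y).le
    have h2 := Real.sq_sqrt (hq k y).le
    nlinarith
  have hsqi : ∀ k, ∫ y, (√(p k y) - √(q k y)) ^ 2 ∂(ν k)
      = 2 - 2 * ∫ y, √(p k y) * √(q k y) ∂(ν k) := by
    intro k
    simp_rw [hsq]
    rw [integral_sub (f := fun y => p k y + q k y) ((hpi k).add (hqi k)) ((hai k).const_mul 2),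
      integral_add (hpi k) (hqi k), hp1, hq1, integral_const_mul]
    norm_num
  have hsqint : Integrable (fun y => (√(p j y) - √(q j y)) ^ 2) (ν j) := by
    simp_rw [hsq]
    exact ((hpi j).add (hqi j)).sub ((hai j).const_mul 2)
  have hA0 : ∀ k, 0 ≤ ∫ y, √(p k y) * √(q k y) ∂(ν k) := fun k =>
    integral_nonneg fun y => by positivity
  have hA1 : ∀ k, ∫ y, √(p k y) * √(q k y) ∂(ν k) ≤ 1 := fun k => by
    have h := hsqi k
    have h0 : 0 ≤ ∫ y, (√(p k y) - √(q k y)) ^ 2 ∂(ν k) :=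
      integral_nonneg fun y => by positivity
    linarith
  have hprod : ∏ k, ∫ y, √(p k y) * √(q k y) ∂(ν k) ≤ ∫ y, √(p j y) * √(q j y) ∂(ν j) := by
    rw [← Finset.mul_prod_erase _ _ (Finset.mem_univ j)]
    exact mul_le_of_le_one_right (hA0 j) (Finset.prod_le_one (fun k _ => hA0 k) fun k _ => hA1 k)
  rw [← ofReal_integral_eq_lintegral_ofReal hsqint (ae_of_all _ fun y => by positivity)]
  apply ENNReal.ofReal_le_ofReal
  rw [hsqi]
  have hPi : Integrable (fun y : ∀ k, Z k => ∏ k, p k (y k)) (Measure.pi ν) :=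
    Integrable.fintype_prod_dep hpi
  have hQi : Integrable (fun y : ∀ k, Z k => ∏ k, √(p k (y k)) * √(q k (y k))) (Measure.pi ν) :=
    Integrable.fintype_prod_dep (f := fun k y => √(p k y) * √(q k y)) hai
  have hlow : ∫ y : ∀ k, Z k, (2 * ∏ k, p k (y k) - 2 * ∏ k, √(p k (y k)) * √(q k (y k)))
      ∂(Measure.pi ν) = 2 - 2 * ∏ k, ∫ y, √(p k y) * √(q k y) ∂(ν k) := by
    rw [integral_sub (hPi.const_mul 2) (hQi.const_mul 2), integral_const_mul, integral_const_mul,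
      integral_fintype_prod_eq_prod p,
      integral_fintype_prod_eq_prod (fun k y => √(p k y) * √(q k y))]
    simp [hp1]
  calc _ ≤ 2 - 2 * ∏ k, ∫ y, √(p k y) * √(q k y) ∂(ν k) := by linarith
    _ = _ := hlow.symm
    _ ≤ _ := by
      refine integral_mono ((hPi.const_mul 2).sub (hQi.const_mul 2)) hint fun y => ?_
      have hP : 0 < ∏ k, p k (y k) := Finset.prod_pos fun k _ => hp k _
      have hQ : 0 < ∏ k, q k (y k) := Finset.prod_pos fun k _ => hq k _
      have hs : ∏ k, √(p k (y k)) * √(q k (y k)) = √(∏ k, p k (y k)) * √(∏ k, q k (y k)) := by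
        rw [Finset.prod_mul_distrib, Real.sqrt_prod _ (fun k _ => (hp k _).le),
          Real.sqrt_prod _ (fun k _ => (hq k _).le)]
      simp only [hs]
      generalize (∏ k, p k (y k)) = P at *
      generalize (∏ k, q k (y k)) = Q at *
      have hPs : 0 < √P := Real.sqrt_pos.2 hP
      have hQs : 0 < √Q := Real.sqrt_pos.2 hQ
      have h1 : Real.log (P / Q) = - (2 * Real.log (√Q / √P)) := by
        rw [Real.log_div hP.ne' hQ.ne', Real.log_div hQs.ne' hPs.ne', Real.log_sqrt hP.le,
          Real.log_sqrt hQ.le]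
        ring
      have h2 : Real.log (√Q / √P) ≤ √Q / √P - 1 := Real.log_le_sub_one_of_pos (by positivity)
      have h3 : P * (√Q / √P) = √P * √Q := by
        field_simp
        rw [Real.sq_sqrt hP.le]
      rw [h1]
      nlinarith [mul_le_mul_of_nonneg_left h2 hP.le]

/-- Factors of a strictly positive product function with unit integrals are positive. -/
lemma factor_pos {ι : Type*} [Fintype ι] {Z : ι → Type*} [∀ k, MeasurableSpace (Z k)]
    (ν : ∀ k, Measure (Z k)) (q : ∀ k, Z k → ℝ)
    (hq1 : ∀ k, ∫ y, q k y ∂(ν k) = 1)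
    (hpos : ∀ y : ∀ k, Z k, 0 < ∏ k, q k (y k)) (k : ι) (z : Z k) : 0 < q k z := by
  classical
  have hne : ∀ k, Nonempty (Z k) := fun k => by
    by_contra h
    rw [not_nonempty_iff] at h
    have := hq1 k
    rw [Measure.eq_zero_of_isEmpty (ν k)] at this
    simp at this
  let y0 : ∀ k, Z k := fun k => (hne k).some
  have key : ∀ w : Z k, 0 < q k w * ∏ l ∈ Finset.univ.erase k, q l (y0 l) := by
    intro w
    have h := hpos (Function.update y0 k w)
    rw [← Finset.mul_prod_erase _ _ (Finset.mem_univ k)] at h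
    have h2 : ∏ l ∈ Finset.univ.erase k, q l (Function.update y0 k w l)
        = ∏ l ∈ Finset.univ.erase k, q l (y0 l) := by
      refine Finset.prod_congr rfl fun l hl => ?_
      rw [Function.update_of_ne (Finset.ne_of_mem_erase hl)]
    rw [h2] at h
    simpa using h
  set C := ∏ l ∈ Finset.univ.erase k, q l (y0 l) with hC
  rcases lt_trichotomy C 0 with hc | hc | hc
  · exfalso
    have hneg : ∀ w, q k w ≤ 0 := fun w => by
      by_contra h
      push Not at h
      nlinarith [key w, mul_neg_of_pos_of_neg h hc]
    have := integral_nonpos (μ := ν k) (f := q k) hneg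
    rw [hq1] at this
    linarith
  · have := key z
    simp [hc] at this
  · exact pos_of_mul_pos_left (key z) hc.le

lemma measurable_restr (T : Finset (Fin (N + M))) :
    Measurable (restr T : (∀ i, X i) → _) :=
  measurable_pi_lambda _ fun i => measurable_pi_apply i.val

lemma ae_cond_iff (μ : Measure (∀ i, X i)) [IsProbabilityMeasure μ] (E : Set (∀ i, X i))
    (hE : MeasurableSet E) (P : (∀ i, X i) → Prop) :
    (∀ᵐ x ∂(condMeasure μ E), P x) ↔ ∀ᵐ x ∂μ, x ∈ E → P x := by
  have h : (μ E)⁻¹ ≠ 0 := ENNReal.inv_ne_zero.2 (measure_ne_top μ E)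
  rw [condMeasure, Measure.ae_ennreal_smul_measure_eq h, ae_restrict_iff' hE]

/-- The KL functional dominates the Hellinger distance of the `j`-th factor. -/
lemma lower_bound (μ : Measure (∀ i, X i)) [IsProbabilityMeasure μ]
    (ν : ∀ j, Measure (Y j)) [∀ j, SigmaFinite (ν j)]
    (pj : ∀ j, (∀ i, X i) → Y j → ℝ) (hp : IsFTD ν pj)
    (E : Set (∀ i, X i)) (hE : MeasurableSet E)
    (G : Fin N → Finset (Fin (N + M))) (j : Fin N)
    (f : (∀ i, X i) → (∀ j, Y j) → ℝ) (hf : MemF ν E G f) :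
    ∃ h : ((i : {i // i ∈ G j}) → X i.val) → Y j → ℝ, Measurable (Function.uncurry h) ∧
      (∀ x ∈ E, ∀ y, 0 < h (restr (G j) x) y) ∧
      ∫⁻ x, ∫⁻ y, ENNReal.ofReal ((√(pj j x y) - √(h (restr (G j) x) y)) ^ 2) ∂(ν j)
        ∂(condMeasure μ E) ≤ klE μ ν (Pfull pj) f E := by
  obtain ⟨-, hfpos, -, fj, hm, h1, hfac⟩ := hf
  have hpos : ∀ x ∈ E, ∀ k y, 0 < fj k (restr (G k) x) y := fun x hx k y =>
    factor_pos ν (fun k y => fj k (restr (G k) x) y) (fun k => h1 k x hx)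
      (fun y => by rw [← hfac x hx y]; exact hfpos x y) k y
  refine ⟨fj j, hm j, fun x hx y => hpos x hx j y, ?_⟩
  unfold klE
  refine lintegral_mono_ae ((ae_cond_iff μ E hE _).2 (ae_of_all _ fun x hx => ?_))
  split_ifs with hint
  · simp only [Pfull, hfac x hx] at hint ⊢
    exact hellinger_le ν (fun k => pj k x) (fun k => fj k (restr (G k) x))
      (fun k => (hp.measurable k).comp measurable_prodMk_left)
      (fun k => (hm k).comp measurable_prodMk_left)
      (fun k y => hp.pos k x y) (fun k y => hpos x hx k y) (fun k => hp.density k x)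
      (fun k => h1 k x hx) hint j
  · exact le_top

/-- If the KL infimum vanishes, then `G j` is a local parent set for `j`. -/
lemma isLPS_of_inf_zero (μ : Measure (∀ i, X i)) [IsProbabilityMeasure μ]
    (ν : ∀ j, Measure (Y j)) [∀ j, SigmaFinite (ν j)]
    (pj : ∀ j, (∀ i, X i) → Y j → ℝ) (hp : IsFTD ν pj)
    (E : Set (∀ i, X i)) (hE : MeasurableSet E)
    (G : Fin N → Finset (Fin (N + M))) (j : Fin N)
    (hinf : ⨅ f ∈ {f | MemF ν E G f}, klE μ ν (Pfull pj) f E = 0) :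
    IsLPS μ ν pj E j (G j) := by
  obtain ⟨ε, hε, hsum⟩ := ENNReal.exists_pos_sum_of_countable' (ε := 1) one_ne_zero ℕ
  have hex : ∀ n, ∃ h : ((i : {i // i ∈ G j}) → X i.val) → Y j → ℝ,
      Measurable (Function.uncurry h) ∧ (∀ x ∈ E, ∀ y, 0 < h (restr (G j) x) y) ∧
      ∫⁻ x, ∫⁻ y, ENNReal.ofReal ((√(pj j x y) - √(h (restr (G j) x) y)) ^ 2) ∂(ν j)
        ∂(condMeasure μ E) ≤ ε n := by
    intro n
    have hlt := hε n
    rw [← hinf] at hlt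
    simp only [iInf_lt_iff] at hlt
    obtain ⟨f, hf, hlt⟩ := hlt
    obtain ⟨h, a, b, c⟩ := lower_bound μ ν pj hp E hE G j f hf
    exact ⟨h, a, b, c.trans hlt.le⟩
  choose h hm hpos hle using hex
  refine ⟨fun t y => (Filter.limsup (fun n => ENNReal.ofReal (h n t y)) Filter.atTop).toReal,
    ?_, ?_⟩
  · exact (Measurable.limsup fun n => (hm n).ennreal_ofReal).ennreal_toReal
  have hmj : ∀ n, Measurable (fun z : (∀ i, X i) × Y j =>
      ENNReal.ofReal ((√(pj j z.1 z.2) - √(h n (restr (G j) z.1) z.2)) ^ 2)) := by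
    intro n
    have a : Measurable fun z : (∀ i, X i) × Y j => pj j z.1 z.2 := hp.measurable j
    have b : Measurable fun z : (∀ i, X i) × Y j => h n (restr (G j) z.1) z.2 :=
      (hm n).comp (((measurable_restr (G j)).comp measurable_fst).prodMk measurable_snd)
    exact ((a.sqrt.sub b.sqrt).pow_const 2).ennreal_ofReal
  have hmx : ∀ n, Measurable (fun x => ∫⁻ y,
      ENNReal.ofReal ((√(pj j x y) - √(h n (restr (G j) x) y)) ^ 2) ∂(ν j)) := fun n =>
    (hmj n).lintegral_prod_right'
  have htot : ∫⁻ x, ∑' n, ∫⁻ y,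
      ENNReal.ofReal ((√(pj j x y) - √(h n (restr (G j) x) y)) ^ 2) ∂(ν j)
        ∂(condMeasure μ E) ≠ ∞ := by
    rw [lintegral_tsum fun n => (hmx n).aemeasurable]
    exact (((ENNReal.tsum_le_tsum hle).trans_lt hsum).trans ENNReal.one_lt_top).ne
  have hae := (ae_cond_iff μ E hE _).1 (ae_lt_top (Measurable.tsum hmx) htot)
  filter_upwards [hae] with x hx hxE
  have hx := hx hxE
  have hmy : ∀ n, Measurable (fun y =>
      ENNReal.ofReal ((√(pj j x y) - √(h n (restr (G j) x) y)) ^ 2)) := fun n =>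
    (hmj n).comp measurable_prodMk_left
  rw [← lintegral_tsum fun n => (hmy n).aemeasurable] at hx
  filter_upwards [ae_lt_top (Measurable.tsum hmy) hx.ne] with y hy
  have h0 := ENNReal.tendsto_atTop_zero_of_tsum_ne_top hy.ne
  have h1 : Filter.Tendsto (fun n => (√(pj j x y) - √(h n (restr (G j) x) y)) ^ 2)
      Filter.atTop (nhds 0) := by
    have := (ENNReal.tendsto_toReal ENNReal.zero_ne_top).comp h0
    simpa [Function.comp_def, ENNReal.toReal_ofReal, sq_nonneg] using this
  have h2 : Filter.Tendsto (fun n => √(pj j x y) - √(h n (restr (G j) x) y))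
      Filter.atTop (nhds 0) := by
    have := h1.sqrt
    simp only [Real.sqrt_sq_eq_abs, Real.sqrt_zero] at this
    exact (tendsto_zero_iff_abs_tendsto_zero _).2 this
  have h3 : Filter.Tendsto (fun n => h n (restr (G j) x) y) Filter.atTop (nhds (pj j x y)) := by
    have := ((tendsto_const_nhds (x := √(pj j x y))).sub h2).pow 2
    simp only [sub_sub_cancel, sub_zero, Real.sq_sqrt (hp.pos j x y).le] at this
    refine this.congr fun n => Real.sq_sqrt (hpos n x hxE y).le
  have h4 := (ENNReal.tendsto_ofReal h3).limsup_eq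
  simp only [h4, ENNReal.toReal_ofReal (hp.pos j x y).le]

/-- if `G` misses an edge `(i,j)` of the local causal graph `G_E`, then no
member of `F_E(G)` agrees with `p` a.e. on `E`, and the infimum of `KL_E(p, ·)` over
`F_E(G)` is strictly positive. -/
theorem kl_inf_pos_of_missing_edge
    (hN : 0 < N) (hM : 0 < M)
    [∀ i, StandardBorelSpace (X i)] [∀ j, StandardBorelSpace (Y j)]
    (μ : Measure (∀ i, X i)) [IsProbabilityMeasure μ]
    (ν : ∀ j, Measure (Y j)) [∀ j, SigmaFinite (ν j)]
    (pj : ∀ j, (∀ i, X i) → Y j → ℝ) (hp : IsFTD ν pj)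
    (E : Set (∀ i, X i)) (hE : MeasurableSet E) (hEpos : 0 < μ E)
    (hfaith : Faithful μ ν pj E)
    (Pa : Fin N → Finset (Fin (N + M)))
    (hPa : ∀ j, IsMinLPS μ ν pj E j (Pa j))
    (G : Fin N → Finset (Fin (N + M)))
    (j : Fin N) (i : Fin (N + M)) (hi : i ∈ Pa j) (hiG : i ∉ G j) :
    (¬ ∃ f, MemF ν E G f ∧
        ∀ᵐ x ∂μ, x ∈ E → (∀ᵐ y ∂(Measure.pi ν), f x y = Pfull pj x y)) ∧
      0 < ⨅ f ∈ {f | MemF ν E G f}, klE μ ν (Pfull pj) f E := by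
  have hnot : ¬ IsLPS μ ν pj E j (G j) := fun h => hiG (hfaith j (Pa j) (G j) (hPa j) h hi)
  have hinf : ⨅ f ∈ {f | MemF ν E G f}, klE μ ν (Pfull pj) f E ≠ 0 := fun h =>
    hnot (isLPS_of_inf_zero μ ν pj hp E hE G j h)
  refine ⟨?_, pos_iff_ne_zero.2 hinf⟩
  rintro ⟨f, hf, hae⟩
  apply hinf
  have hz : klE μ ν (Pfull pj) f E = 0 := by
    unfold klE
    rw [← lintegral_zero (μ := condMeasure μ E)]
    refine lintegral_congr_ae ((ae_cond_iff μ E hE _).2 ?_)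
    filter_upwards [hae] with x hx hxE
    have h0 : (fun y => Pfull pj x y * Real.log (Pfull pj x y / f x y))
        =ᵐ[Measure.pi ν] fun _ => (0 : ℝ) := by
      filter_upwards [hx hxE] with y hy
      rw [hy]
      have : Pfull pj x y ≠ 0 := (Finset.prod_pos fun k _ => hp.pos k x (y k)).ne'
      simp [div_self this]
    rw [if_pos ((integrable_zero _ _ _).congr h0.symm), integral_congr_ae h0]
    simp
  refine le_antisymm ?_ zero_le
  exact (iInf₂_le f hf).trans hz.le

end FCDL
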